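/- Theorem A (family version). Let k be an algebraically closed field of characteristic zero and let (Q₁ⁱ,Q₂ⁱ)_{i∈I} be a family of pairs of homogeneous quadratic forms in k[x₁,x₂,x₃,x₄], each pair cutting out a normal elliptic curve Eᵢ ⊂ P³. Then the Jacobian brackets {·,·}_{Q₁ⁱ,Q₂ⁱ} are pairwise compatible (the mixed Jacobiator of any two of them vanishes identically) if and only if either there exists a nonzero quadratic form Q lying in span{Q₁ⁱ,Q₂ⁱ} for every i ∈ I (all curves Eᵢ lie on one common, possibly singular, quadric surface), or there exists a linear subspace W of the space of homogeneous quadratic forms with dim W ≤ 3 such that span{Q₁ⁱ,Q₂ⁱ} ⊆ W for every i ∈ I (every Eᵢ is the intersection of two quadrics in W). -/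

import Mathlib

open MvPolynomial

noncomputable section

/-- The Jacobian bracket `{f,g}_{P,Q}`: the determinant of the 4×4 matrix whose
columns are the gradients ∇f, ∇g, ∇P, ∇Q. -/
def jacBracket {k : Type*} [Field k] (P Q f g : MvPolynomial (Fin 4) k) :
    MvPolynomial (Fin 4) k :=
  Matrix.det (Matrix.of fun i j => pderiv i (![f, g, P, Q] j))

/-- Mixed Jacobiator of two brackets. -/
def mixedJacobiator {k : Type*} [Field k]
    (b₁ b₂ : MvPolynomial (Fin 4) k → MvPolynomial (Fin 4) k → MvPolynomial (Fin 4) k)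
    (f g h : MvPolynomial (Fin 4) k) : MvPolynomial (Fin 4) k :=
  b₂ (b₁ f g) h + b₂ (b₁ g h) f + b₂ (b₁ h f) g +
    b₁ (b₂ f g) h + b₁ (b₂ g h) f + b₁ (b₂ h f) g

/-- The gradient of `Q` evaluated at `v`. -/
def gradEval {k : Type*} [Field k] (Q : MvPolynomial (Fin 4) k) (v : Fin 4 → k) :
    Fin 4 → k :=
  fun i => eval v (pderiv i Q)

/-- The pair of quadrics `(Q₁, Q₂)` cuts out a normal elliptic curve in `P³`:
at every nonzero common zero, the gradients are linearly independent. -/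
def CutsOutEllipticCurve {k : Type*} [Field k] (Q₁ Q₂ : MvPolynomial (Fin 4) k) : Prop :=
  ∀ v : Fin 4 → k, v ≠ 0 → eval v Q₁ = 0 → eval v Q₂ = 0 →
    LinearIndependent k ![gradEval Q₁ v, gradEval Q₂ v]

theorem det_fin_four_cols {R : Type*} [CommRing R] (a b c d : Fin 4 → R) :
    Matrix.det (Matrix.of fun i j => ![a i, b i, c i, d i] j) =
      (c 2 * d 3 - c 3 * d 2) * (a 0 * b 1 - a 1 * b 0)
      - (c 1 * d 3 - c 3 * d 1) * (a 0 * b 2 - a 2 * b 0)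
      + (c 1 * d 2 - c 2 * d 1) * (a 0 * b 3 - a 3 * b 0)
      + (c 0 * d 3 - c 3 * d 0) * (a 1 * b 2 - a 2 * b 1)
      - (c 0 * d 2 - c 2 * d 0) * (a 1 * b 3 - a 3 * b 1)
      + (c 0 * d 1 - c 1 * d 0) * (a 2 * b 3 - a 3 * b 2) := by
  simp [Matrix.det_succ_row_zero, Fin.sum_univ_succ, Fin.succAbove]
  ring

section Bivector

variable {k A : Type*} [CommRing k] [CommRing A] [Algebra k A] (D : Fin 4 → Derivation k A A)

/-- The bracket of the bivector `∑ i < j, π i j • D i ∧ D j`. -/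
def bivectorBracket (π : Fin 4 → Fin 4 → A) (f g : A) : A :=
  π 0 1 * (D 0 f * D 1 g - D 1 f * D 0 g) + π 0 2 * (D 0 f * D 2 g - D 2 f * D 0 g) +
    π 0 3 * (D 0 f * D 3 g - D 3 f * D 0 g) + π 1 2 * (D 1 f * D 2 g - D 2 f * D 1 g) +
    π 1 3 * (D 1 f * D 3 g - D 3 f * D 1 g) + π 2 3 * (D 2 f * D 3 g - D 3 f * D 2 g)

/-- A `3 × 3` minor of the Jacobian matrix of `(f, g, h)`. -/
def jacMinor (f g h : A) (a b c : Fin 4) : A :=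
  D a f * (D b g * D c h - D c g * D b h) - D b f * (D a g * D c h - D c g * D a h) +
    D c f * (D a g * D b h - D b g * D a h)

/-- The bracket of `π a b` with the `c`-th coordinate with respect to `ρ`. -/
def bivectorContraction (π ρ : Fin 4 → Fin 4 → A) (a b c : Fin 4) : A :=
  D 0 (π a b) * ρ 0 c + D 1 (π a b) * ρ 1 c + D 2 (π a b) * ρ 2 c + D 3 (π a b) * ρ 3 c

/-- The components of the Schouten bracket of two bivectors. -/
def schoutenComponent (π ρ : Fin 4 → Fin 4 → A) (a b c : Fin 4) : A :=
  bivectorContraction D π ρ a b c + bivectorContraction D π ρ b c a +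
    bivectorContraction D π ρ c a b + bivectorContraction D ρ π a b c +
    bivectorContraction D ρ π b c a + bivectorContraction D ρ π c a b

/-- The bivector dual to the two-form `dP ∧ dQ`. -/
def jacBivector (P Q : A) : Fin 4 → Fin 4 → A :=
  let m := fun i j => D i P * D j Q - D j P * D i Q
  ![![0, m 2 3, -m 1 3, m 1 2], ![-m 2 3, 0, m 0 3, -m 0 2],
    ![m 1 3, -m 0 3, 0, m 0 1], ![-m 1 2, m 0 2, -m 0 1, 0]]

variable {D}

set_option maxHeartbeats 4000000 in
/-- The mixed Jacobiator of two bivector brackets is a triderivation. -/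
theorem bivectorBracket_jacobiator (hD : ∀ i j f, D i (D j f) = D j (D i f))
    {π ρ : Fin 4 → Fin 4 → A} (hπ : ∀ i j, π i j = - π j i) (hρ : ∀ i j, ρ i j = - ρ j i)
    (hπ' : ∀ i, π i i = 0) (hρ' : ∀ i, ρ i i = 0) (f g h : A) :
    bivectorBracket D ρ (bivectorBracket D π f g) h +
      bivectorBracket D ρ (bivectorBracket D π g h) f +
      bivectorBracket D ρ (bivectorBracket D π h f) g +
      bivectorBracket D π (bivectorBracket D ρ f g) h +
      bivectorBracket D π (bivectorBracket D ρ g h) f +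
      bivectorBracket D π (bivectorBracket D ρ h f) g =
    schoutenComponent D π ρ 0 1 2 * jacMinor D f g h 0 1 2 +
      schoutenComponent D π ρ 0 1 3 * jacMinor D f g h 0 1 3 +
      schoutenComponent D π ρ 0 2 3 * jacMinor D f g h 0 2 3 +
      schoutenComponent D π ρ 1 2 3 * jacMinor D f g h 1 2 3 := by
  simp only [bivectorBracket, jacMinor, schoutenComponent, bivectorContraction, map_add, map_sub,
    map_neg, Derivation.leibniz, smul_eq_mul, hD 1 0, hD 2 0, hD 3 0, hD 2 1, hD 3 1, hD 3 2,
    hπ 1 0, hπ 2 0, hπ 3 0, hπ 2 1, hπ 3 1, hπ 3 2,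
    hρ 1 0, hρ 2 0, hρ 3 0, hρ 2 1, hρ 3 1, hρ 3 2, hπ', hρ']
  generalize D 0 f = f0, D 1 f = f1, D 2 f = f2, D 3 f = f3, D 0 g = g0, D 1 g = g1,
    D 2 g = g2, D 3 g = g3, D 0 h = h0, D 1 h = h1, D 2 h = h2, D 3 h = h3
  ring

set_option maxHeartbeats 4000000 in
/-- The Schouten bracket of two Jacobian bivectors is dual to the differential of the
Jacobian determinant of the four functions. -/
theorem schoutenComponent_jacBivector (hD : ∀ i j f, D i (D j f) = D j (D i f)) (P Q R S : A) :
    (schoutenComponent D (jacBivector D P Q) (jacBivector D R S) 0 1 2 =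
      -D 3 (bivectorBracket D (jacBivector D P Q) R S)) ∧
    (schoutenComponent D (jacBivector D P Q) (jacBivector D R S) 0 1 3 =
      D 2 (bivectorBracket D (jacBivector D P Q) R S)) ∧
    (schoutenComponent D (jacBivector D P Q) (jacBivector D R S) 0 2 3 =
      -D 1 (bivectorBracket D (jacBivector D P Q) R S)) ∧
    (schoutenComponent D (jacBivector D P Q) (jacBivector D R S) 1 2 3 =
      D 0 (bivectorBracket D (jacBivector D P Q) R S)) := by
  simp only [schoutenComponent, bivectorContraction, bivectorBracket, jacBivector, Matrix.cons_val,
    map_add, map_sub, map_neg, Derivation.leibniz, smul_eq_mul,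
    hD 1 0, hD 2 0, hD 3 0, hD 2 1, hD 3 1, hD 3 2]
  refine ⟨?_, ?_, ?_, ?_⟩ <;> ring

end Bivector

theorem pderiv_pderiv_comm {k σ : Type*} [CommRing k] (i j : σ) (f : MvPolynomial σ k) :
    pderiv i (pderiv j f) = pderiv j (pderiv i f) := by
  classical
  have h : ⁅(pderiv i : Derivation k (MvPolynomial σ k) (MvPolynomial σ k)),
      (pderiv j : Derivation k (MvPolynomial σ k) (MvPolynomial σ k))⁆ = 0 := by
    refine MvPolynomial.derivation_ext fun l => ?_
    simp [Derivation.commutator_apply, pderiv_X, Pi.single_apply, apply_ite]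
  have := congrArg (fun D => D f) h
  simpa [Derivation.commutator_apply, sub_eq_zero] using this

section QuadricPairs

variable {k : Type*} [Field k]

theorem jacBracket_eq_det (P Q f g : MvPolynomial (Fin 4) k) :
    jacBracket P Q f g = Matrix.det (Matrix.of fun i j =>
      ![pderiv i f, pderiv i g, pderiv i P, pderiv i Q] j) := by
  unfold jacBracket
  congr 2
  ext i j : 2
  fin_cases j <;> rfl

theorem jacBracket_eq_bivectorBracket (P Q : MvPolynomial (Fin 4) k) :
    jacBracket P Q = bivectorBracket (pderiv (R := k)) (jacBivector (pderiv (R := k)) P Q) := by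
  ext1 f
  ext1 g
  rw [jacBracket_eq_det, det_fin_four_cols]
  simp only [bivectorBracket, jacBivector, Matrix.cons_val]
  ring

theorem mixedJacobiator_jacBracket (P Q R S f g h : MvPolynomial (Fin 4) k) :
    mixedJacobiator (jacBracket P Q) (jacBracket R S) f g h =
      -jacBracket h (jacBracket P Q R S) f g := by
  have hanti : ∀ P Q : MvPolynomial (Fin 4) k, ∀ i j,
      jacBivector (pderiv (R := k)) P Q i j = -jacBivector (pderiv (R := k)) P Q j i := by
    intro P Q i j
    fin_cases i <;> fin_cases j <;> simp [jacBivector]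
  have hdiag : ∀ P Q : MvPolynomial (Fin 4) k, ∀ i,
      jacBivector (pderiv (R := k)) P Q i i = 0 := by
    intro P Q i
    fin_cases i <;> simp [jacBivector]
  obtain ⟨h₁, h₂, h₃, h₄⟩ := schoutenComponent_jacBivector (D := pderiv (R := k))
    pderiv_pderiv_comm P Q R S
  rw [mixedJacobiator, jacBracket_eq_det h, det_fin_four_cols, jacBracket_eq_bivectorBracket P Q,
    jacBracket_eq_bivectorBracket R S, bivectorBracket_jacobiator pderiv_pderiv_comm (hanti P Q)
      (hanti R S) (hdiag P Q) (hdiag R S), h₁, h₂, h₃, h₄]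
  simp only [jacMinor]
  ring

section Diagonal

open Matrix

/-- The gradients of the diagonal quadrics with coefficients `a`, `b` and of the quadrics with
matrices `r`, `s` are linearly dependent at every point. -/
def GradientsDependent (a b : Fin 4 → k) (r s : Matrix (Fin 4) (Fin 4) k) : Prop :=
  ∀ y : Fin 4 → k,
    det (of fun i j => ![a i * y i, b i * y i, (r *ᵥ y) i, (s *ᵥ y) i] j) = 0

variable {a b : Fin 4 → k} {r s : Matrix (Fin 4) (Fin 4) k}

theorem GradientsDependent.reindex (h : GradientsDependent a b r s) (σ : Equiv.Perm (Fin 4)) :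
    GradientsDependent (a ∘ σ) (b ∘ σ) (r.submatrix σ σ) (s.submatrix σ σ) := by
  intro y
  have hy := h (y ∘ σ.symm)
  have hr : ∀ m : Matrix (Fin 4) (Fin 4) k, ∀ i,
      (m.submatrix σ σ *ᵥ y) i = (m *ᵥ (y ∘ σ.symm)) (σ i) := by
    intro m i
    rw [submatrix_mulVec_equiv]
    rfl
  have := det_permute σ (of fun i j => ![a i * (y ∘ σ.symm) i, b i * (y ∘ σ.symm) i,
    (r *ᵥ (y ∘ σ.symm)) i, (s *ᵥ (y ∘ σ.symm)) i] j)
  rw [hy, mul_zero] at this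
  rw [← this]
  congr 1
  ext i j
  simp [hr]

theorem exists_perm_of_ne {i j l m : Fin 4} (hij : i ≠ j) (hil : i ≠ l) (him : i ≠ m)
    (hjl : j ≠ l) (hjm : j ≠ m) (hlm : l ≠ m) :
    ∃ σ : Equiv.Perm (Fin 4), σ 0 = i ∧ σ 1 = j ∧ σ 2 = l ∧ σ 3 = m := by
  have hinj : Function.Injective ![i, j, l, m] := by
    intro x y hxy
    fin_cases x <;> fin_cases y <;> simp_all
  exact ⟨Equiv.ofBijective _ hinj.bijective_of_finite, rfl, rfl, rfl, rfl⟩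

theorem exists_complement {i j : Fin 4} (hij : i ≠ j) :
    ∃ l m : Fin 4, i ≠ l ∧ i ≠ m ∧ j ≠ l ∧ j ≠ m ∧ l ≠ m ∧
      ∀ n, n = i ∨ n = j ∨ n = l ∨ n = m := by
  revert i j
  decide

/-- Restrict the quartic `det (∇P, ∇Q, ∇R, ∇S)` to a coordinate plane. -/
theorem GradientsDependent.plane [CharZero k] (h : GradientsDependent a b r s)
    (hc : a 0 * b 1 - a 1 * b 0 ≠ 0) :
    r 2 0 * s 3 0 = r 3 0 * s 2 0 ∧
      r 2 0 * s 3 1 + r 2 1 * s 3 0 = r 3 0 * s 2 1 + r 3 1 * s 2 0 := by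
  have key : ∀ t : k, t ≠ 0 → (r 2 0 + r 2 1 * t) * (s 3 0 + s 3 1 * t) =
      (r 3 0 + r 3 1 * t) * (s 2 0 + s 2 1 * t) := by
    intro t ht
    have := h ![1, t, 0, 0]
    rw [det_fin_four_cols] at this
    simp [-mul_eq_zero, mulVec, dotProduct, Fin.sum_univ_four] at this
    refine mul_left_cancel₀ (mul_ne_zero hc ht) ?_
    linear_combination this
  have h₁ := key 1 one_ne_zero
  have h₂ := key (-1) (by simp)
  have h₃ := key 2 two_ne_zero
  have h₄ := key (-2) (by simp)
  refine ⟨mul_left_cancel₀ (show (6 : k) ≠ 0 by norm_num) ?_,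
    mul_left_cancel₀ (show (2 : k) ≠ 0 by norm_num) ?_⟩
  · linear_combination 4 * h₁ + 4 * h₂ - h₃ - h₄
  · linear_combination h₁ - h₂

/-- The off-diagonal parts of `r` and `s` are proportional. -/
theorem GradientsDependent.offDiag [CharZero k] (h : GradientsDependent a b r s)
    (hc : ∀ i j, i ≠ j → a i * b j - a j * b i ≠ 0) (hr : r.IsSymm) (hs : s.IsSymm)
    {i j l m : Fin 4} (hij : i ≠ j) (hlm : l ≠ m) : r i j * s l m = r l m * s i j := by
  have hr' : ∀ i j, r i j = r j i := fun i j => hr.apply j i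
  have hs' : ∀ i j, s i j = s j i := fun i j => hs.apply j i
  have plane : ∀ i j l m : Fin 4, i ≠ j → i ≠ l → i ≠ m → j ≠ l → j ≠ m → l ≠ m →
      r l i * s m i = r m i * s l i ∧
        r l i * s m j + r l j * s m i = r m i * s l j + r m j * s l i := by
    intro i j l m hij hil him hjl hjm hlm
    obtain ⟨σ, rfl, rfl, rfl, rfl⟩ := exists_perm_of_ne hij hil him hjl hjm hlm
    exact (h.reindex σ).plane (hc _ _ hij)
  have adj : ∀ i j l : Fin 4, i ≠ j → i ≠ l → r i j * s i l = r i l * s i j := by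
    intro i j l hij hil
    obtain rfl | hjl := eq_or_ne j l
    · rfl
    obtain ⟨n, hin, hjn, hln⟩ : ∃ n, i ≠ n ∧ j ≠ n ∧ l ≠ n := by
      clear * -
      revert i j l
      decide
    have := (plane i n j l hin hij hil hjn.symm hln.symm hjl).1
    rwa [hr' j i, hr' l i, hs' j i, hs' l i] at this
  by_cases hil : i = l
  · subst hil
    exact adj i j m hij hlm
  by_cases him : i = m
  · subst him
    rw [hr' l, hs' l]
    exact adj i j l hij hil
  by_cases hjl : j = l
  · subst hjl
    rw [hr' i, hs' i]
    exact adj j i m hij.symm hlm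
  by_cases hjm : j = m
  · subst hjm
    rw [hr' i, hs' i, hr' l, hs' l]
    exact adj j i l hij.symm hjl
  have h₁ := (plane i l j m hil hij him (Ne.symm hjl) hlm hjm).2
  have h₂ := (plane i m j l him hij hil (Ne.symm hjm) hlm.symm hjl).2
  have h₃ := (plane l m i j hlm (Ne.symm hil) (Ne.symm hjl) (Ne.symm him) (Ne.symm hjm) hij).2
  simp only [hr' j i, hr' l i, hr' m i, hr' m l,
    hs' j i, hs' l i, hs' m i, hs' m l] at h₁ h₂ h₃
  refine mul_left_cancel₀ (show (2 : k) ≠ 0 by norm_num) ?_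
  linear_combination h₁ + h₂ + h₃

theorem GradientsDependent.minor_eq_zero [CharZero k] {d : Fin 4 → k}
    (h : GradientsDependent a b (diagonal d) s) (hs : s 3 0 ≠ 0) :
    a 0 * (b 1 * d 2 - b 2 * d 1) - b 0 * (a 1 * d 2 - a 2 * d 1) +
      d 0 * (a 1 * b 2 - a 2 * b 1) = 0 := by
  have key : ∀ t : k, t ≠ 0 → (a 0 * (b 1 * d 2 - b 2 * d 1) - b 0 * (a 1 * d 2 - a 2 * d 1) +
      d 0 * (a 1 * b 2 - a 2 * b 1)) * (s 3 0 * t + s 3 1 + s 3 2) = 0 := by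
    intro t ht
    have := h ![t, 1, 1, 0]
    rw [det_fin_four_cols] at this
    simp [-mul_eq_zero, mulVec, dotProduct, Fin.sum_univ_four, diagonal_apply] at this
    refine (mul_eq_zero.1 ?_).resolve_left ht
    linear_combination this
  have h₁ := key 1 one_ne_zero
  have h₂ := key 2 two_ne_zero
  refine (mul_eq_zero.1 ?_).resolve_right hs
  linear_combination h₂ - h₁

theorem GradientsDependent.of_diagonal [CharZero k] {d : Fin 4 → k}
    (h : GradientsDependent a b (diagonal d) s) (hs : s.IsSymm)
    (hc : ∀ i j, i ≠ j → a i * b j - a j * b i ≠ 0) :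
    ∃ p q t u : k, (t ≠ 0 ∨ u ≠ 0) ∧
      p • diagonal a + q • diagonal b + t • diagonal d + u • s = 0 := by
  by_cases hoff : ∀ i j, i ≠ j → s i j = 0
  · have hdet := h 1
    obtain ⟨v, hv, hv'⟩ := exists_mulVec_eq_zero_iff.2 hdet
    have hrow : ∀ i, a i * v 0 + b i * v 1 + d i * v 2 + s i i * v 3 = 0 := by
      intro i
      have hsi : (s *ᵥ 1) i = s i i := by
        rw [mulVec, dotProduct, Finset.sum_eq_single i]
        · simp
        · intro j _ hj
          simp [hoff i j hj.symm]
        · simp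
      have := congrFun hv' i
      rw [mulVec, dotProduct, Fin.sum_univ_four] at this
      simp only [of_apply, cons_val, hsi, mulVec_diagonal, Pi.one_apply, mul_one,
        Pi.zero_apply] at this
      exact this
    refine ⟨v 0, v 1, v 2, v 3, ?_, ?_⟩
    · by_contra! hcon
      have h₀ := hrow 0
      have h₁ := hrow 1
      rw [hcon.1, hcon.2] at h₀ h₁
      have hc' := hc 0 1 (by decide)
      have e₀ : v 0 = 0 := (mul_eq_zero.1 (by linear_combination b 1 * h₀ - b 0 * h₁ :
        (a 0 * b 1 - a 1 * b 0) * v 0 = 0)).resolve_left hc'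
      have e₁ : v 1 = 0 := (mul_eq_zero.1 (by linear_combination a 0 * h₁ - a 1 * h₀ :
        (a 0 * b 1 - a 1 * b 0) * v 1 = 0)).resolve_left hc'
      refine hv (funext fun i => ?_)
      fin_cases i
      exacts [e₀, e₁, hcon.1, hcon.2]
    · ext i j
      obtain rfl | hij := eq_or_ne i j
      · simp
        linear_combination hrow i
      · simp [hij, hoff i j hij]
  · push Not at hoff
    obtain ⟨i, j, hij, hsij⟩ := hoff
    obtain ⟨l, m, hil, him, hjl, hjm, hlm, hall⟩ := exists_complement hij
    have minor : ∀ i j : Fin 4, i ≠ j → i ≠ l → i ≠ m → j ≠ l → j ≠ m → s j i ≠ 0 →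
        a i * (b l * d m - b m * d l) - b i * (a l * d m - a m * d l) +
          d i * (a l * b m - a m * b l) = 0 := by
      intro i j hij hil him hjl hjm hsij
      obtain ⟨σ, rfl, rfl, rfl, rfl⟩ :=
        exists_perm_of_ne hil him hij hlm hjl.symm hjm.symm
      have := h.reindex σ
      rw [submatrix_diagonal_equiv] at this
      exact this.minor_eq_zero hsij
    have h₁ := minor i j hij hil him hjl hjm (by rwa [hs.apply])
    have h₂ := minor j i hij.symm hjl hjm hil him hsij
    refine ⟨b l * d m - b m * d l, -(a l * d m - a m * d l), a l * b m - a m * b l, 0,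
      Or.inl (hc l m hlm), ?_⟩
    ext x y
    obtain rfl | hxy := eq_or_ne x y
    · simp
      obtain rfl | rfl | rfl | rfl := hall x
      · linear_combination h₁
      · linear_combination h₂
      · ring
      · ring
    · simp [hxy]

theorem GradientsDependent.smul_add_smul (h : GradientsDependent a b r s) (t u t' u' : k) :
    GradientsDependent a b (t • r + u • s) (t' • r + u' • s) := by
  intro y
  have := h y
  rw [det_fin_four_cols] at this ⊢
  simp only [add_mulVec, smul_mulVec, Pi.add_apply, Pi.smul_apply, smul_eq_mul]
  linear_combination (t * u' - u * t') * this

theorem GradientsDependent.exists_relation [CharZero k] (h : GradientsDependent a b r s)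
    (hr : r.IsSymm) (hs : s.IsSymm) (hc : ∀ i j, i ≠ j → a i * b j - a j * b i ≠ 0) :
    ∃ p q t u : k, (t ≠ 0 ∨ u ≠ 0) ∧
      p • diagonal a + q • diagonal b + t • r + u • s = 0 := by
  obtain ⟨t, u, htu, hd⟩ : ∃ t u : k, (t ≠ 0 ∨ u ≠ 0) ∧
      t • r + u • s = diagonal (diag (t • r + u • s)) := by
    by_cases hoff : ∀ i j, i ≠ j → r i j = 0
    · refine ⟨1, 0, Or.inl one_ne_zero, ?_⟩
      ext i j
      obtain rfl | hij := eq_or_ne i j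
      · simp
      · simp [hij, hoff i j hij]
    · push Not at hoff
      obtain ⟨i, j, hij, hrij⟩ := hoff
      refine ⟨s i j, -r i j, Or.inr (neg_ne_zero.2 hrij), ?_⟩
      ext l m
      obtain rfl | hlm := eq_or_ne l m
      · simp
      · simp [hlm]
        linear_combination -h.offDiag hc hr hs hij hlm
  obtain ht | hu := htu
  · have h' := h.smul_add_smul t u 0 1
    rw [hd] at h'
    obtain ⟨p, q, t', u', htu', hrel⟩ := h'.of_diagonal (by simpa using hs) hc
    rw [← hd] at hrel
    refine ⟨p, q, t' * t, t' * u + u', ?_, ?_⟩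
    · by_cases ht' : t' = 0
      · right
        simpa [ht'] using htu'
      · exact Or.inl (mul_ne_zero ht' ht)
    · rw [← hrel]
      module
  · have h' := h.smul_add_smul t u 1 0
    rw [hd] at h'
    obtain ⟨p, q, t', u', htu', hrel⟩ := h'.of_diagonal (by simpa using hr) hc
    rw [← hd] at hrel
    refine ⟨p, q, t' * t + u', t' * u, ?_, ?_⟩
    · by_cases ht' : t' = 0
      · left
        simpa [ht'] using htu'
      · exact Or.inr (mul_ne_zero ht' hu)
    · rw [← hrel]
      module

end Diagonal

section Pencil

open Module

/-- At every nonzero common isotropic vector, the differentials of the two quadratic forms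
are linearly independent. -/
def IsRegularPencil {V : Type*} [AddCommGroup V] [Module k V] (A B : LinearMap.BilinForm k V) :
    Prop :=
  ∀ v, v ≠ 0 → A v v = 0 → B v v = 0 → ∀ α β : k, α • A v + β • B v = 0 → α = 0 ∧ β = 0

theorem exists_pencil_kernel [IsAlgClosed k] {V : Type*} [AddCommGroup V] [Module k V]
    [FiniteDimensional k V] [Nontrivial V] (A B : LinearMap.BilinForm k V) :
    ∃ v, v ≠ 0 ∧ ∃ α β : k, (α ≠ 0 ∨ β ≠ 0) ∧ α • A v + β • B v = 0 := by
  by_cases hA : Function.Injective A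
  · let e : V ≃ₗ[k] Dual k V :=
      LinearEquiv.ofInjectiveOfFinrankEq A hA Subspace.dual_finrank_eq.symm
    obtain ⟨c, hc⟩ := Module.End.exists_eigenvalue (e.symm.toLinearMap ∘ₗ B)
    obtain ⟨v, hv⟩ := hc.exists_hasEigenvector
    refine ⟨v, hv.2, c, -1, Or.inr (by simp), ?_⟩
    have h := congrArg e hv.apply_eq_smul
    have he : e v = A v := rfl
    rw [LinearMap.comp_apply, LinearEquiv.coe_coe, LinearEquiv.apply_symm_apply,
      map_smul, he] at h
    rw [h]
    module
  · obtain ⟨v, hv, hv0⟩ : ∃ v, A v = 0 ∧ v ≠ 0 := by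
      by_contra! hcon
      exact hA ((injective_iff_map_eq_zero A).2 hcon)
    exact ⟨v, hv0, 1, 0, Or.inl one_ne_zero, by simp [hv]⟩

/-- A common eigenvector of a regular pencil has a common orthogonal complement. -/
theorem IsRegularPencil.exists_split [IsAlgClosed k] {V : Type*} [AddCommGroup V] [Module k V]
    [FiniteDimensional k V] [Nontrivial V] {A B : LinearMap.BilinForm k V}
    (h : IsRegularPencil A B) :
    ∃ (v : V) (f : Dual k V), f v ≠ 0 ∧ ∃ a b : k, A v = a • f ∧ B v = b • f := by
  obtain ⟨v, hv, α, β, hαβ, hrel⟩ := exists_pencil_kernel A B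
  have hrel' : ∀ w, α * A v w + β * B v w = 0 := fun w => by
    simpa using congrArg (fun g : Dual k V => g w) hrel
  by_cases hA : A v v = 0
  · by_cases hB : B v v = 0
    · obtain ⟨rfl, rfl⟩ := h v hv hA hB α β hrel
      simp at hαβ
    · have hβ : β = 0 := by
        have := hrel' v
        rw [hA, mul_zero, zero_add] at this
        exact (mul_eq_zero.1 this).resolve_right hB
      subst hβ
      refine ⟨v, B v, hB, 0, 1, ?_, (one_smul k _).symm⟩
      have hα : α ≠ 0 := by simpa using hαβ
      simpa [hα] using hrel
  · have hβ : β ≠ 0 := by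
      rintro rfl
      have hα : α ≠ 0 := by simpa using hαβ
      have := hrel' v
      simp [hα, hA] at this
    refine ⟨v, A v, hA, 1, -(α / β), (one_smul k _).symm, ?_⟩
    ext w
    have := hrel' w
    simp only [LinearMap.smul_apply, smul_eq_mul]
    field_simp
    linear_combination this

/-- A regular pencil of symmetric bilinear forms is simultaneously diagonalizable. -/
theorem IsRegularPencil.exists_orthogonal_basis [IsAlgClosed k] (n : ℕ) :
    ∀ {V : Type*} [AddCommGroup V] [Module k V] [FiniteDimensional k V]
      {A B : LinearMap.BilinForm k V}, finrank k V = n → A.IsSymm → B.IsSymm →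
      IsRegularPencil A B →
      ∃ v : Basis (Fin n) k V, ∀ i j, i ≠ j → A (v i) (v j) = 0 ∧ B (v i) (v j) = 0 := by
  induction n with
  | zero =>
    intro V _ _ _ A B hn _ _ _
    exact ⟨finBasisOfFinrankEq k V hn, fun i => i.elim0⟩
  | succ n ih =>
    intro V _ _ _ A B hn hA hB h
    have : Nontrivial V := nontrivial_of_finrank_pos (R := k) (by omega)
    obtain ⟨v, f, hfv, a, b, hAv, hBv⟩ := h.exists_split
    have hker : ∀ w ∈ LinearMap.ker f, A v w = 0 ∧ B v w = 0 := by
      intro w hw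
      rw [LinearMap.mem_ker] at hw
      simp [hAv, hBv, hw]
    have hdecomp : ∀ w, ∃ c : k, w + c • v ∈ LinearMap.ker f := fun w =>
      ⟨-(f w / f v), by simp [LinearMap.mem_ker, hfv]⟩
    have hfin : finrank k (LinearMap.ker f) = n := by
      have h₁ := f.finrank_range_add_finrank_ker
      have h₂ : finrank k (LinearMap.range f) = 1 := by
        rw [LinearMap.range_eq_top.2 (LinearMap.surjective (by rintro rfl; simp at hfv)),
          finrank_top, finrank_self]
      omega
    have hreg : IsRegularPencil (A.restrict (LinearMap.ker f)) (B.restrict (LinearMap.ker f)) := by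
      intro w hw hAw hBw α β hrel
      refine h w (by simpa using hw) hAw hBw α β ?_
      ext x
      obtain ⟨c, hc⟩ := hdecomp x
      have h₁ := congrArg (fun g : Dual k (LinearMap.ker f) => g ⟨_, hc⟩) hrel
      obtain ⟨h₂, h₃⟩ := hker w w.2
      have h₂' : A w v = 0 := by rw [hA.eq]; exact h₂
      have h₃' : B w v = 0 := by rw [hB.eq]; exact h₃
      simpa [h₂', h₃'] using h₁
    obtain ⟨u, hu⟩ := ih hfin (hA.restrict _) (hB.restrict _) hreg
    refine ⟨Basis.mkFinCons v u ?_ hdecomp, ?_⟩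
    · intro c x hx hc
      have := congrArg f hc
      rw [LinearMap.mem_ker] at hx
      simpa [hx, hfv] using this
    · rw [Basis.coe_mkFinCons]
      intro i j
      refine Fin.cases ?_ (fun i => ?_) i <;> refine Fin.cases ?_ (fun j => ?_) j <;> intro hij <;>
        simp only [Fin.cons_zero, Fin.cons_succ, Function.comp_apply]
      · exact (hij rfl).elim
      · exact hker _ (u j).2
      · rw [hA.eq, hB.eq]
        exact hker _ (u i).2
      · exact hu i j (ne_of_apply_ne _ hij)

theorem exists_ne_zero_of_det_two {a b c d : k} (h : a * d - b * c = 0) :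
    ∃ x y : k, (x ≠ 0 ∨ y ≠ 0) ∧ a * x + b * y = 0 ∧ c * x + d * y = 0 := by
  have hdet : Matrix.det !![a, b; c, d] = 0 := by rwa [Matrix.det_fin_two_of]
  obtain ⟨v, hv, hv'⟩ := Matrix.exists_mulVec_eq_zero_iff.2 hdet
  have h₀ := congrFun hv' 0
  have h₁ := congrFun hv' 1
  simp [Matrix.mulVec, dotProduct] at h₀ h₁
  refine ⟨v 0, v 1, ?_, h₀, h₁⟩
  by_contra! hcon
  exact hv (funext fun i => by fin_cases i; exacts [hcon.1, hcon.2])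

/-- The diagonal entries of a regular pencil give pairwise distinct points of the line. -/
theorem IsRegularPencil.apply_basis_ne [IsAlgClosed k] {V ι : Type*} [Fintype ι] [AddCommGroup V]
    [Module k V] {A B : LinearMap.BilinForm k V} (h : IsRegularPencil A B) (v : Basis ι k V)
    (hv : ∀ i j, i ≠ j → A (v i) (v j) = 0 ∧ B (v i) (v j) = 0) {i j : ι} (hij : i ≠ j) :
    A (v i) (v i) * B (v j) (v j) - A (v j) (v j) * B (v i) (v i) ≠ 0 := by
  intro hzero
  obtain ⟨x, y, hxy, hxA, hxB⟩ := exists_ne_zero_of_det_two hzero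
  obtain ⟨α, β, hαβ, hi, hj⟩ := exists_ne_zero_of_det_two
    (a := A (v i) (v i)) (b := B (v i) (v i)) (c := A (v j) (v j)) (d := B (v j) (v j))
    (by linear_combination hzero)
  obtain ⟨s, rfl⟩ := IsAlgClosed.exists_pow_nat_eq x two_pos
  obtain ⟨t, rfl⟩ := IsAlgClosed.exists_pow_nat_eq y two_pos
  obtain ⟨hAij, hBij⟩ := hv i j hij
  obtain ⟨hAji, hBji⟩ := hv j i hij.symm
  have hw : s • v i + t • v j ≠ 0 := by
    intro h0
    have hs := congrArg (fun w => v.repr w i) h0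
    have ht := congrArg (fun w => v.repr w j) h0
    simp [hij, hij.symm] at hs ht
    simp [hs, ht] at hxy
  have := h _ hw (by simp [hAij, hAji]; linear_combination hxA)
    (by simp [hBij, hBji]; linear_combination hxB) α β (v.ext fun l => by
      by_cases hli : l = i
      · subst hli
        simp [hAji, hBji]
        linear_combination s * hi
      by_cases hlj : l = j
      · subst hlj
        simp [hAij, hBij]
        linear_combination t * hj
      have h₁ := hv i l (Ne.symm hli)
      have h₂ := hv j l (Ne.symm hlj)
      simp [h₁, h₂])
  simp [this] at hαβ

end Pencil

section Hessian

open Matrix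

/-- The Hessian matrix of a quadratic form. -/
def hessian : MvPolynomial (Fin 4) k →ₗ[k] Matrix (Fin 4) (Fin 4) k where
  toFun P := of fun i j => coeff 0 (pderiv j (pderiv i P))
  map_add' P Q := by ext; simp
  map_smul' c P := by ext; simp

theorem hessian_isSymm (P : MvPolynomial (Fin 4) k) : (hessian P).IsSymm := by
  ext i j
  simp [hessian, pderiv_pderiv_comm i j]

variable {P Q R S : MvPolynomial (Fin 4) k}

theorem pderiv_eq_sum_hessian (hP : P.IsHomogeneous 2) (i : Fin 4) :
    pderiv i P = ∑ j, C (hessian P i j) * X j := by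
  have h₁ : (pderiv i P).IsHomogeneous 1 := hP.pderiv
  have h := h₁.sum_X_mul_pderiv
  rw [one_smul] at h
  rw [← h]
  refine Finset.sum_congr rfl fun j _ => ?_
  have h₀ : (pderiv j (pderiv i P)).IsHomogeneous 0 := h₁.pderiv
  rw [mul_comm]
  congr 1
  exact (totalDegree_eq_zero_iff_eq_C.1 (Nat.le_zero.1 h₀.totalDegree_le))

theorem gradEval_eq_hessian_mulVec (hP : P.IsHomogeneous 2) (v : Fin 4 → k) :
    gradEval P v = hessian P *ᵥ v := by
  ext i
  simp [gradEval, pderiv_eq_sum_hessian hP, mulVec, dotProduct]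

theorem two_mul_eval_eq (hP : P.IsHomogeneous 2) (v : Fin 4 → k) :
    2 * eval v P = v ⬝ᵥ hessian P *ᵥ v := by
  have h := congrArg (eval v) hP.sum_X_mul_pderiv
  simp only [map_sum, map_mul, eval_X, nsmul_eq_mul, Nat.cast_ofNat] at h
  simp only [map_ofNat] at h
  rw [← h, ← gradEval_eq_hessian_mulVec hP]
  rfl

theorem eq_zero_of_hessian_eq_zero [CharZero k] (hP : P.IsHomogeneous 2) (h : hessian P = 0) :
    P = 0 := by
  have h' := hP.sum_X_mul_pderiv
  simpa [pderiv_eq_sum_hessian hP, h] using h'.symm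

theorem isRegularPencil_hessian [CharZero k] (hP : P.IsHomogeneous 2) (hQ : Q.IsHomogeneous 2)
    (h : CutsOutEllipticCurve P Q) :
    IsRegularPencil (toBilin' (hessian P)) (toBilin' (hessian Q)) := by
  intro v hv hPv hQv α β hrel
  rw [toBilin'_apply', ← two_mul_eval_eq hP] at hPv
  rw [toBilin'_apply', ← two_mul_eval_eq hQ] at hQv
  have hli := h v hv (by simpa using hPv) (by simpa using hQv)
  rw [gradEval_eq_hessian_mulVec hP, gradEval_eq_hessian_mulVec hQ,
    LinearIndependent.pair_iff] at hli
  refine hli α β (dotProduct_eq_zero _ fun w => ?_)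
  have hw := congrArg (fun g : Module.Dual k (Fin 4 → k) => g w) hrel
  simpa [toBilin'_apply', dotProduct_mulVec, ← mulVec_transpose, (hessian_isSymm _).eq] using hw

/-- Simultaneous diagonalization of the Hessians of a pencil cutting out an elliptic curve. -/
theorem CutsOutEllipticCurve.exists_diagonalization [IsAlgClosed k] [CharZero k]
    (hP : P.IsHomogeneous 2) (hQ : Q.IsHomogeneous 2) (h : CutsOutEllipticCurve P Q) :
    ∃ (M : Matrix (Fin 4) (Fin 4) k) (a b : Fin 4 → k), IsUnit M ∧
      Mᵀ * hessian P * M = diagonal a ∧ Mᵀ * hessian Q * M = diagonal b ∧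
      ∀ i j, i ≠ j → a i * b j - a j * b i ≠ 0 := by
  have hreg := isRegularPencil_hessian hP hQ h
  have hsymm : ∀ P : MvPolynomial (Fin 4) k, (toBilin' (hessian P)).IsSymm := fun P =>
    isSymm_toBilin'_iff_isSymm.2 (hessian_isSymm P)
  obtain ⟨v, hv⟩ := IsRegularPencil.exists_orthogonal_basis 4 (by simp) (hsymm P) (hsymm Q) hreg
  have hentry : ∀ (H : Matrix (Fin 4) (Fin 4) k) (i j),
      ((of fun i j => v j i)ᵀ * H * (of fun i j => v j i)) i j = toBilin' H (v i) (v j) := by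
    intro H i j
    rw [toBilin'_apply', Matrix.mul_assoc, mul_apply]
    rfl
  refine ⟨of fun i j => v j i, fun i => toBilin' (hessian P) (v i) (v i),
    fun i => toBilin' (hessian Q) (v i) (v i), ?_, ?_, ?_, fun i j hij =>
    hreg.apply_basis_ne v hv hij⟩
  · have hM : (of fun i j => v j i) = (Pi.basisFun k (Fin 4)).toMatrix v := by
      ext i j
      simp [Module.Basis.toMatrix_apply]
    rw [hM]
    have := (Pi.basisFun k (Fin 4)).invertibleToMatrix v
    exact isUnit_of_invertible _
  · ext i j
    rw [hentry]
    obtain rfl | hij := eq_or_ne i j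
    · simp
    · rw [diagonal_apply_ne _ hij, (hv i j hij).1]
  · ext i j
    rw [hentry]
    obtain rfl | hij := eq_or_ne i j
    · simp
    · rw [diagonal_apply_ne _ hij, (hv i j hij).2]

theorem CutsOutEllipticCurve.linearIndependent [IsAlgClosed k] [CharZero k]
    (hP : P.IsHomogeneous 2) (hQ : Q.IsHomogeneous 2) (h : CutsOutEllipticCurve P Q) :
    LinearIndependent k ![P, Q] := by
  obtain ⟨M, a, b, -, ha, hb, hab⟩ := h.exists_diagonalization hP hQ
  rw [LinearIndependent.pair_iff]
  intro p q hpq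
  have hd : diagonal (p • a + q • b) = 0 := by
    have := congrArg (fun H => Mᵀ * hessian H * M) hpq
    simp only [map_add, map_smul, map_zero, Matrix.mul_add, Matrix.add_mul, Matrix.mul_smul,
      Matrix.smul_mul, ha, hb, ← diagonal_smul, diagonal_add, Matrix.mul_zero, Matrix.zero_mul] at this
    exact this
  rw [diagonal_eq_zero] at hd
  have h₀ := congrFun hd 0
  have h₁ := congrFun hd 1
  simp at h₀ h₁
  have hc := hab 0 1 (by decide)
  exact ⟨(mul_eq_zero.1 (by linear_combination b 1 * h₀ - b 0 * h₁ :
      (a 0 * b 1 - a 1 * b 0) * p = 0)).resolve_left hc,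
    (mul_eq_zero.1 (by linear_combination a 0 * h₁ - a 1 * h₀ :
      (a 0 * b 1 - a 1 * b 0) * q = 0)).resolve_left hc⟩

/-- Four quadrics with vanishing Jacobian determinant, two of which cut out an elliptic curve,
are linearly dependent. -/
theorem CutsOutEllipticCurve.exists_relation [IsAlgClosed k] [CharZero k]
    (hP : P.IsHomogeneous 2) (hQ : Q.IsHomogeneous 2) (hR : R.IsHomogeneous 2)
    (hS : S.IsHomogeneous 2) (h : CutsOutEllipticCurve P Q) (hdet : jacBracket P Q R S = 0) :
    ∃ p q t u : k, (t ≠ 0 ∨ u ≠ 0) ∧ p • P + q • Q + t • R + u • S = 0 := by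
  obtain ⟨M, a, b, hM, ha, hb, hab⟩ := h.exists_diagonalization hP hQ
  have hsymm : ∀ P : MvPolynomial (Fin 4) k, (Mᵀ * hessian P * M).IsSymm := fun P => by
    simp [IsSymm, Matrix.mul_assoc, (hessian_isSymm P).eq]
  have hdep : GradientsDependent a b (Mᵀ * hessian R * M) (Mᵀ * hessian S * M) := by
    intro y
    have heval : det (of fun i j => ![gradEval R (M *ᵥ y) i, gradEval S (M *ᵥ y) i,
        gradEval P (M *ᵥ y) i, gradEval Q (M *ᵥ y) i] j) = 0 := by
      have := congrArg (eval (M *ᵥ y)) hdet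
      rw [jacBracket_eq_det, RingHom.map_det, map_zero] at this
      rw [← this]
      congr 1
      ext i j
      fin_cases j <;> rfl
    have hmul : det (of fun i j => ![(diagonal a *ᵥ y) i, (diagonal b *ᵥ y) i,
        ((Mᵀ * hessian R * M) *ᵥ y) i, ((Mᵀ * hessian S * M) *ᵥ y) i] j) =
        det (Mᵀ * of fun i j => ![gradEval P (M *ᵥ y) i, gradEval Q (M *ᵥ y) i,
          gradEval R (M *ᵥ y) i, gradEval S (M *ᵥ y) i] j) := by
      rw [← ha, ← hb]
      simp only [← mulVec_mulVec, gradEval_eq_hessian_mulVec hP, gradEval_eq_hessian_mulVec hQ,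
        gradEval_eq_hessian_mulVec hR, gradEval_eq_hessian_mulVec hS]
      congr 1
      ext i j
      fin_cases j <;> rfl
    simp only [mulVec_diagonal] at hmul
    rw [hmul, det_mul]
    refine mul_eq_zero_of_right _ ?_
    rw [det_fin_four_cols] at heval ⊢
    linear_combination heval
  obtain ⟨p, q, t, u, htu, hrel⟩ := hdep.exists_relation (hsymm R) (hsymm S) hab
  refine ⟨p, q, t, u, htu, eq_zero_of_hessian_eq_zero ?_ ?_⟩
  · rw [← mem_homogeneousSubmodule] at *
    exact add_mem (add_mem (add_mem (Submodule.smul_mem _ _ hP) (Submodule.smul_mem _ _ hQ))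
      (Submodule.smul_mem _ _ hR)) (Submodule.smul_mem _ _ hS)
  · have h0 : Mᵀ * hessian (p • P + q • Q + t • R + u • S) * M = 0 := by
      rw [← hrel, ← ha, ← hb]
      simp [Matrix.mul_add, Matrix.add_mul]
    have hMt : IsUnit Mᵀ := (isUnit_transpose M).2 hM
    rwa [hM.mul_left_eq_zero, hMt.mul_right_eq_zero] at h0

end Hessian

section Pairs

variable {P Q R S : MvPolynomial (Fin 4) k}

theorem jacBracket_isHomogeneous (hP : P.IsHomogeneous 2) (hQ : Q.IsHomogeneous 2)
    (hR : R.IsHomogeneous 2) (hS : S.IsHomogeneous 2) : (jacBracket P Q R S).IsHomogeneous 4 := by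
  rw [jacBracket, Matrix.det_apply]
  refine IsHomogeneous.sum _ _ _ fun σ _ => ?_
  have : (∏ i, (Matrix.of fun i j => pderiv i (![R, S, P, Q] j)) (σ i) i).IsHomogeneous
      (∑ _ : Fin 4, 1) := by
    refine IsHomogeneous.prod _ _ _ fun i _ => ?_
    fin_cases i
    exacts [hR.pderiv, hS.pderiv, hP.pderiv, hQ.pderiv]
  rw [← mem_homogeneousSubmodule] at *
  rcases Int.units_eq_one_or (Equiv.Perm.sign σ) with h | h <;> simpa [h] using this

theorem mixedJacobiator_eq_zero_iff [CharZero k] (hP : P.IsHomogeneous 2)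
    (hQ : Q.IsHomogeneous 2) (hR : R.IsHomogeneous 2) (hS : S.IsHomogeneous 2) :
    (∀ f g h, mixedJacobiator (jacBracket P Q) (jacBracket R S) f g h = 0) ↔
      jacBracket P Q R S = 0 := by
  simp only [mixedJacobiator_jacBracket, neg_eq_zero]
  constructor
  · intro h
    have hD : ∀ i, pderiv i (jacBracket P Q R S) = 0 := by
      have h₀ := h (X 1) (X 2) (X 3)
      have h₁ := h (X 0) (X 2) (X 3)
      have h₂ := h (X 0) (X 1) (X 3)
      have h₃ := h (X 0) (X 1) (X 2)
      rw [jacBracket_eq_det, det_fin_four_cols] at h₀ h₁ h₂ h₃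
      simp [pderiv_X] at h₀ h₁ h₂ h₃
      intro i
      fin_cases i
      exacts [h₀, h₁, h₂, h₃]
    have := (jacBracket_isHomogeneous hP hQ hR hS).sum_X_mul_pderiv
    simpa [hD] using this.symm
  · intro h f g l
    rw [h, jacBracket_eq_det, det_fin_four_cols]
    simp

/-- The brackets of two elliptic curves are compatible iff their pencils meet. -/
theorem compatible_iff_inf_ne_bot [IsAlgClosed k] [CharZero k] (hP : P.IsHomogeneous 2)
    (hQ : Q.IsHomogeneous 2) (hR : R.IsHomogeneous 2) (hS : S.IsHomogeneous 2)
    (h : CutsOutEllipticCurve P Q) (h' : CutsOutEllipticCurve R S) :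
    (∀ f g h, mixedJacobiator (jacBracket P Q) (jacBracket R S) f g h = 0) ↔
      ∃ q ∈ Submodule.span k {P, Q}, q ∈ Submodule.span k {R, S} ∧ q ≠ 0 := by
  rw [mixedJacobiator_eq_zero_iff hP hQ hR hS]
  constructor
  · intro hdet
    obtain ⟨p, q, t, u, htu, hrel⟩ := h.exists_relation hP hQ hR hS hdet
    refine ⟨(-p) • P + (-q) • Q, Submodule.mem_span_pair.2 ⟨_, _, rfl⟩,
      Submodule.mem_span_pair.2 ⟨t, u, ?_⟩, fun h0 => ?_⟩
    · rw [← sub_eq_zero, ← hrel]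
      module
    · have h1 : t • R + u • S = 0 := by
        rw [← hrel, ← sub_eq_zero, ← h0]
        module
      have := LinearIndependent.pair_iff.1 (h'.linearIndependent hR hS) t u h1
      simp [this] at htu
  · rintro ⟨q, hq, hq', hq0⟩
    obtain ⟨a, b, rfl⟩ := Submodule.mem_span_pair.1 hq
    obtain ⟨c, d, hcd⟩ := Submodule.mem_span_pair.1 hq'
    refine Matrix.exists_mulVec_eq_zero_iff.1 ⟨![C c, C d, -C a, -C b], ?_, ?_⟩
    · intro h0
      have ha := congrFun h0 2
      have hb := congrFun h0 3
      simp at ha hb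
      simp [ha, hb] at hq0
    · ext1 i
      have := congrArg (pderiv i) hcd
      simp only [map_add, Derivation.map_smul] at this
      simp only [smul_eq_C_mul] at this
      simp [Matrix.mulVec, dotProduct, Fin.sum_univ_four]
      linear_combination this

end Pairs

section Family

open Module

theorem exists_smul_of_mem_inf {V : Type*} [AddCommGroup V] [Module k V] {U W : Submodule k V}
    (hU : finrank k U = 2) (hUW : ¬U ≤ W) {x y : V} (hx : x ∈ U ⊓ W) (hy : y ∈ U ⊓ W)
    (hx0 : x ≠ 0) : ∃ c : k, c • x = y := by
  have : FiniteDimensional k U := finite_of_finrank_pos (by omega)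
  have hlt := Submodule.finrank_lt_finrank_of_lt (inf_lt_left.2 hUW)
  have hpos : 0 < finrank k ↥(U ⊓ W) :=
    finrank_pos_iff_exists_ne_zero.2 ⟨⟨x, hx⟩, by simpa using hx0⟩
  obtain ⟨c, hc⟩ := exists_smul_eq_of_finrank_eq_one
    (by omega : finrank k ↥(U ⊓ W) = 1) (x := ⟨x, hx⟩) (by simpa using hx0) ⟨y, hy⟩
  exact ⟨c, congrArg Subtype.val hc⟩

theorem mem_of_smul_mem {V : Type*} [AddCommGroup V] [Module k V] {U : Submodule k V} {c : k}
    {x y : V} (h : c • x = y) (hy : y ∈ U) (hy0 : y ≠ 0) : x ∈ U := by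
  subst h
  exact (U.smul_mem_iff (by rintro rfl; simp at hy0)).1 hy

/-- A family of pairwise intersecting lines in projective space has a common point or lies in
a plane. -/
theorem exists_common_or_le_of_pairwise_meet {V I : Type*} [AddCommGroup V] [Module k V]
    [Nontrivial V] (L : I → Submodule k V) (hL : ∀ i, finrank k (L i) = 2)
    (hmeet : ∀ i j, ∃ q ∈ L i, q ∈ L j ∧ q ≠ 0) :
    (∃ q : V, q ≠ 0 ∧ ∀ i, q ∈ L i) ∨
      ∃ W : Submodule k V, W ≤ ⨆ i, L i ∧ Module.rank k W ≤ 3 ∧ ∀ i, L i ≤ W := by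
  have hfin : ∀ i, FiniteDimensional k (L i) := fun i =>
    finite_of_finrank_pos (by rw [hL]; omega)
  by_cases hI : ∃ i₀ i₁, ¬L i₀ ≤ L i₁
  · obtain ⟨i₀, i₁, hne⟩ := hI
    obtain ⟨q, hq₀, hq₁, hq⟩ := hmeet i₀ i₁
    have hmem : ∀ j, ¬L j ≤ L i₀ ⊔ L i₁ → q ∈ L j := by
      intro j hj
      obtain ⟨x, hxj, hx₀, hx⟩ := hmeet j i₀
      obtain ⟨y, hyj, hy₁, hy⟩ := hmeet j i₁
      obtain ⟨c, rfl⟩ := exists_smul_of_mem_inf (hL j) hj ⟨hxj, Submodule.mem_sup_left hx₀⟩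
        ⟨hyj, Submodule.mem_sup_right hy₁⟩ hx
      obtain ⟨c', hc'⟩ := exists_smul_of_mem_inf (hL i₀) hne ⟨hq₀, hq₁⟩
        ⟨(L i₀).smul_mem c hx₀, hy₁⟩ hq
      exact mem_of_smul_mem hc' hyj hy
    by_cases hall : ∀ j, L j ≤ L i₀ ⊔ L i₁
    · refine Or.inr ⟨L i₀ ⊔ L i₁, sup_le (le_iSup L i₀) (le_iSup L i₁), ?_, hall⟩
      have h₁ := Submodule.finrank_sup_add_finrank_inf_eq (L i₀) (L i₁)
      have hpos : 0 < finrank k ↥(L i₀ ⊓ L i₁) :=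
        finrank_pos_iff_exists_ne_zero.2 ⟨⟨q, hq₀, hq₁⟩, fun h => hq (congrArg Subtype.val h)⟩
      rw [hL, hL] at h₁
      rw [← finrank_eq_rank]
      exact_mod_cast (by omega : finrank k ↥(L i₀ ⊔ L i₁) ≤ 3)
    · push Not at hall
      obtain ⟨i₂, hi₂⟩ := hall
      refine Or.inl ⟨q, hq, fun j => ?_⟩
      by_cases hj : L j ≤ L i₀ ⊔ L i₁
      · obtain ⟨y, hyj, hy₂, hy⟩ := hmeet j i₂
        obtain ⟨c, hc⟩ := exists_smul_of_mem_inf (hL i₂) hi₂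
          ⟨hmem i₂ hi₂, Submodule.mem_sup_left hq₀⟩ ⟨hy₂, hj hyj⟩ hq
        exact mem_of_smul_mem hc hyj hy
      · exact hmem j hj
  · push Not at hI
    left
    rcases isEmpty_or_nonempty I with hE | ⟨⟨i⟩⟩
    · obtain ⟨q, hq⟩ := exists_ne (0 : V)
      exact ⟨q, hq, fun i => hE.elim i⟩
    · obtain ⟨q, hqi, -, hq⟩ := hmeet i i
      exact ⟨q, hq, fun j => hI i j hqi⟩

/-- Two lines in a projective plane meet. -/
theorem exists_mem_of_le_of_rank_le_three {V : Type*} [AddCommGroup V] [Module k V]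
    {U U' W : Submodule k V} (hU : finrank k U = 2) (hU' : finrank k U' = 2)
    (hW : Module.rank k W ≤ 3) (hUW : U ≤ W) (hUW' : U' ≤ W) : ∃ q ∈ U, q ∈ U' ∧ q ≠ 0 := by
  have : FiniteDimensional k U := finite_of_finrank_pos (by omega)
  have : FiniteDimensional k U' := finite_of_finrank_pos (by omega)
  have : FiniteDimensional k W :=
    rank_lt_aleph0_iff.1 (hW.trans_lt (by exact_mod_cast Cardinal.natCast_lt_aleph0 (n := 3)))
  have hW' : finrank k W ≤ 3 := finrank_le_of_rank_le (by exact_mod_cast hW)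
  have h₁ := Submodule.finrank_sup_add_finrank_inf_eq U U'
  have h₂ := Submodule.finrank_mono (sup_le hUW hUW')
  have hpos : 0 < finrank k ↥(U ⊓ U') := by omega
  obtain ⟨⟨q, hq⟩, hq0⟩ := finrank_pos_iff_exists_ne_zero.1 hpos
  exact ⟨q, hq.1, hq.2, by simpa using hq0⟩

end Family

end QuadricPairs

/-- Theorem A (family version): the Feigin–Odesskii brackets of a family of normal
elliptic curves in `P³` are pairwise compatible iff either all the curves lie on a
common quadric, or all the pencils of quadrics lie in a common ≤3-dimensional space
of quadratic forms. -/
theorem theoremA_family {k : Type*} [Field k] [IsAlgClosed k] [CharZero k]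
    {I : Type*} (Q₁ Q₂ : I → MvPolynomial (Fin 4) k)
    (hhom : ∀ i, (Q₁ i).IsHomogeneous 2 ∧ (Q₂ i).IsHomogeneous 2)
    (hell : ∀ i, CutsOutEllipticCurve (Q₁ i) (Q₂ i)) :
    (∀ i j : I, ∀ f g h : MvPolynomial (Fin 4) k,
        mixedJacobiator (jacBracket (Q₁ i) (Q₂ i)) (jacBracket (Q₁ j) (Q₂ j)) f g h = 0) ↔
      (∃ Q : MvPolynomial (Fin 4) k, Q ≠ 0 ∧
          ∀ i, Q ∈ Submodule.span k {Q₁ i, Q₂ i}) ∨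
        (∃ W : Submodule k (MvPolynomial (Fin 4) k),
          (∀ q ∈ W, q.IsHomogeneous 2) ∧ Module.rank k W ≤ 3 ∧
            ∀ i, Submodule.span k {Q₁ i, Q₂ i} ≤ W) := by
  have hrank : ∀ i, Module.finrank k (Submodule.span k {Q₁ i, Q₂ i}) = 2 := by
    intro i
    have := finrank_span_eq_card ((hell i).linearIndependent (hhom i).1 (hhom i).2)
    rwa [Matrix.range_cons_cons_empty, Fintype.card_fin] at this
  have hpair : ∀ i j, _ := fun i j => compatible_iff_inf_ne_bot (hhom i).1 (hhom i).2 (hhom j).1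
    (hhom j).2 (hell i) (hell j)
  simp only [hpair]
  constructor
  · intro h
    refine (exists_common_or_le_of_pairwise_meet (fun i => Submodule.span k {Q₁ i, Q₂ i})
      hrank h).imp_right ?_
    rintro ⟨W, hW, hW', hle⟩
    refine ⟨W, fun q hq => ?_, hW', hle⟩
    rw [← mem_homogeneousSubmodule]
    refine iSup_le (fun i => Submodule.span_le.2 ?_) (hW hq)
    rintro p (rfl | rfl)
    exacts [(hhom i).1, (hhom i).2]
  · rintro (⟨q, hq, hmem⟩ | ⟨W, -, hW, hle⟩) i j
    · exact ⟨q, hmem i, hmem j, hq⟩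
    · exact exists_mem_of_le_of_rank_le_three (hrank i) (hrank j) hW (hle i) (hle j)
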